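/- Case 1 of Theorem 1.2: the hypergeometric group Γ(f,g) generated by the companion matrices A and B of f(x) = x^5 - 2x^4 + x^3 - x^2 + 2x - 1 and g(x) = x^5 + x^4 + 2x^3 + 2x^2 + x + 1 is an arithmetic subgroup of the integral orthogonal group O_Q(ℤ): Γ(f,g) is contained in O_Q(ℤ) (in particular Aᵀ·Q·A = Q and Bᵀ·Q·B = Q), and Γ(f,g) has finite index in O_Q(ℤ). -/

import Mathlib

open Matrix

/-- The companion matrix `A` of `f(x) = x^5 - 2*x^4 + x^3 - x^2 + 2*x - 1`. -/
def matA : Matrix (Fin 5) (Fin 5) ℤ :=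
  !![(0 : ℤ), 0, 0, 0, 1; 1, 0, 0, 0, -2; 0, 1, 0, 0, 1; 0, 0, 1, 0, -1; 0, 0, 0, 1, 2]

/-- The companion matrix `B` of `g(x) = x^5 + x^4 + 2*x^3 + 2*x^2 + x + 1`. -/
def matB : Matrix (Fin 5) (Fin 5) ℤ :=
  !![(0 : ℤ), 0, 0, 0, -1; 1, 0, 0, 0, -1; 0, 1, 0, 0, -2; 0, 0, 1, 0, -2; 0, 0, 0, 1, -1]

/-- The symmetric integer matrix `Q` of the quadratic form preserved by `Γ(f,g)`. -/
def matQ : Matrix (Fin 5) (Fin 5) ℤ :=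
  !![(5 : ℤ), -5, -3, 11, 5; -5, 5, -5, -3, 11; -3, -5, 5, -5, -3; 11, -3, -5, 5, -5; 5, 11, -3, -5, 5]

/-- The integral orthogonal group `O_Q(ℤ)` of a matrix `Q`, as the subgroup of `GL₅(ℤ)`
consisting of all `M` with `Mᵀ * Q * M = Q`. -/
def orthogonalSubgroup (Q : Matrix (Fin 5) (Fin 5) ℤ) : Subgroup (GL (Fin 5) ℤ) where
  carrier := { M : GL (Fin 5) ℤ |
      (M : Matrix (Fin 5) (Fin 5) ℤ)ᵀ * Q * (M : Matrix (Fin 5) (Fin 5) ℤ) = Q }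
  one_mem' := by simp
  mul_mem' := by
    intro a b ha hb
    simp only [Set.mem_setOf_eq, Units.val_mul, transpose_mul] at ha hb ⊢
    calc ((b : Matrix (Fin 5) (Fin 5) ℤ)ᵀ * (a : Matrix (Fin 5) (Fin 5) ℤ)ᵀ) * Q *
          ((a : Matrix (Fin 5) (Fin 5) ℤ) * (b : Matrix (Fin 5) (Fin 5) ℤ))
        = (b : Matrix (Fin 5) (Fin 5) ℤ)ᵀ *
            ((a : Matrix (Fin 5) (Fin 5) ℤ)ᵀ * Q * (a : Matrix (Fin 5) (Fin 5) ℤ)) *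
            (b : Matrix (Fin 5) (Fin 5) ℤ) := by
          simp only [mul_assoc]
      _ = Q := by rw [ha, hb]
  inv_mem' := by
    intro a ha
    simp only [Set.mem_setOf_eq] at ha ⊢
    calc ((a⁻¹ : GL (Fin 5) ℤ) : Matrix (Fin 5) (Fin 5) ℤ)ᵀ * Q *
          ((a⁻¹ : GL (Fin 5) ℤ) : Matrix (Fin 5) (Fin 5) ℤ)
        = ((a⁻¹ : GL (Fin 5) ℤ) : Matrix (Fin 5) (Fin 5) ℤ)ᵀ *
            ((a : Matrix (Fin 5) (Fin 5) ℤ)ᵀ * Q * (a : Matrix (Fin 5) (Fin 5) ℤ)) *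
            ((a⁻¹ : GL (Fin 5) ℤ) : Matrix (Fin 5) (Fin 5) ℤ) := by rw [ha]
      _ = ((a : Matrix (Fin 5) (Fin 5) ℤ) *
            ((a⁻¹ : GL (Fin 5) ℤ) : Matrix (Fin 5) (Fin 5) ℤ))ᵀ * Q *
          ((a : Matrix (Fin 5) (Fin 5) ℤ) *
            ((a⁻¹ : GL (Fin 5) ℤ) : Matrix (Fin 5) (Fin 5) ℤ)) := by
          simp only [transpose_mul, mul_assoc]
      _ = Q := by rw [Units.mul_inv]; simp


/-! ### Explicit 5×5 integer matrices, as data the kernel can compute with -/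

namespace HG

/-- A row of five integers. -/
structure R5 where
  (a b c d e : ℤ)

/-- A 5×5 integer matrix, given by its rows. -/
structure M5 where
  (r0 r1 r2 r3 r4 : R5)

def R5.beq (x y : R5) : Bool :=
  decide (x.a = y.a) && (decide (x.b = y.b) && (decide (x.c = y.c) &&
    (decide (x.d = y.d) && decide (x.e = y.e))))

theorem R5.eq_of_beq {x y : R5} (h : R5.beq x y = true) : x = y := by
  cases x; cases y
  simp only [R5.beq, Bool.and_eq_true, decide_eq_true_eq] at h
  obtain ⟨h1, h2, h3, h4, h5⟩ := h
  subst h1 h2 h3 h4 h5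
  rfl

def M5.beq (x y : M5) : Bool :=
  R5.beq x.r0 y.r0 && (R5.beq x.r1 y.r1 && (R5.beq x.r2 y.r2 &&
    (R5.beq x.r3 y.r3 && R5.beq x.r4 y.r4)))

theorem M5.eq_of_beq {x y : M5} (h : M5.beq x y = true) : x = y := by
  cases x; cases y
  simp only [M5.beq, Bool.and_eq_true] at h
  obtain ⟨h1, h2, h3, h4, h5⟩ := h
  rw [M5.mk.injEq]
  exact ⟨R5.eq_of_beq h1, R5.eq_of_beq h2, R5.eq_of_beq h3, R5.eq_of_beq h4, R5.eq_of_beq h5⟩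

def rowMul (r : R5) (m : M5) : R5 :=
  ⟨r.a * m.r0.a + r.b * m.r1.a + r.c * m.r2.a + r.d * m.r3.a + r.e * m.r4.a,
   r.a * m.r0.b + r.b * m.r1.b + r.c * m.r2.b + r.d * m.r3.b + r.e * m.r4.b,
   r.a * m.r0.c + r.b * m.r1.c + r.c * m.r2.c + r.d * m.r3.c + r.e * m.r4.c,
   r.a * m.r0.d + r.b * m.r1.d + r.c * m.r2.d + r.d * m.r3.d + r.e * m.r4.d,
   r.a * m.r0.e + r.b * m.r1.e + r.c * m.r2.e + r.d * m.r3.e + r.e * m.r4.e⟩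

def mul (x y : M5) : M5 :=
  ⟨rowMul x.r0 y, rowMul x.r1 y, rowMul x.r2 y, rowMul x.r3 y, rowMul x.r4 y⟩

def one : M5 :=
  ⟨⟨1, 0, 0, 0, 0⟩, ⟨0, 1, 0, 0, 0⟩, ⟨0, 0, 1, 0, 0⟩, ⟨0, 0, 0, 1, 0⟩, ⟨0, 0, 0, 0, 1⟩⟩

abbrev Mat := Matrix (Fin 5) (Fin 5) ℤ

def R5.vec (r : R5) : Fin 5 → ℤ := ![r.a, r.b, r.c, r.d, r.e]

def toMat (x : M5) : Mat := Matrix.of ![x.r0.vec, x.r1.vec, x.r2.vec, x.r3.vec, x.r4.vec]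

theorem toMat_mul (x y : M5) : toMat (mul x y) = toMat x * toMat y := by
  ext i j
  fin_cases i <;> fin_cases j <;>
    simp [toMat, mul, rowMul, R5.vec, Matrix.mul_apply, Fin.sum_univ_succ] <;> ring

theorem toMat_one : toMat one = 1 := by
  ext i j
  fin_cases i <;> fin_cases j <;> simp [toMat, one, R5.vec]

/-- Product of the letters named by a word, times `z`. -/
def wprod (Ls : List M5) (z : M5) : List ℕ → M5
  | [] => z
  | i :: w => mul (Ls.getD i one) (wprod Ls z w)

/-- Lists of generators together with their inverses. -/
abbrev Gens := List (M5 × M5)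

def letters : Gens → List M5
  | [] => []
  | p :: l => p.1 :: p.2 :: letters l

def okG (G : Gens) : Bool :=
  G.all fun p => M5.beq (mul p.1 p.2) one && M5.beq (mul p.2 p.1) one

def grp (G : Gens) : Subgroup (GL (Fin 5) ℤ) :=
  Subgroup.closure {g | ∃ p ∈ G, (g : Mat) = toMat p.1}

/-- `X` is the matrix of an element of `H`. -/
def Mem (H : Subgroup (GL (Fin 5) ℤ)) (X : M5) : Prop := ∃ g ∈ H, (g : Mat) = toMat X

theorem Mem.one (H : Subgroup (GL (Fin 5) ℤ)) : Mem H one :=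
  ⟨1, H.one_mem, by rw [toMat_one]; rfl⟩

theorem Mem.mul {H : Subgroup (GL (Fin 5) ℤ)} {X Y : M5} (hX : Mem H X) (hY : Mem H Y) :
    Mem H (mul X Y) := by
  obtain ⟨g, hg, hgX⟩ := hX
  obtain ⟨k, hk, hkY⟩ := hY
  exact ⟨g * k, H.mul_mem hg hk, by rw [toMat_mul, ← hgX, ← hkY]; rfl⟩

theorem Mem.getD {H : Subgroup (GL (Fin 5) ℤ)} {Ls : List M5} (hL : ∀ X ∈ Ls, Mem H X) (i : ℕ) :
    Mem H (Ls.getD i HG.one) := by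
  rw [List.getD_eq_getElem?_getD]
  cases h : Ls[i]? with
  | none => exact Mem.one H
  | some X => exact hL X (List.mem_of_getElem? h)

theorem wprod_mul (Ls : List M5) (z : M5) (w : List ℕ) :
    toMat (wprod Ls z w) = toMat (wprod Ls one w) * toMat z := by
  induction w with
  | nil => simp [wprod, toMat_one]
  | cons i w ih => simp only [wprod, toMat_mul, ih, mul_assoc]

theorem Mem.wprod {H : Subgroup (GL (Fin 5) ℤ)} {Ls : List M5} (hL : ∀ X ∈ Ls, Mem H X)
    (w : List ℕ) : Mem H (wprod Ls HG.one w) := by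
  induction w with
  | nil => exact Mem.one H
  | cons i w ih => exact Mem.mul (Mem.getD hL i) ih

theorem okG_pair {G : Gens} (h : okG G = true) {p : M5 × M5} (hp : p ∈ G) :
    toMat p.1 * toMat p.2 = 1 ∧ toMat p.2 * toMat p.1 = 1 := by
  have := List.all_eq_true.1 h p hp
  rw [Bool.and_eq_true] at this
  rw [← toMat_mul, ← toMat_mul, M5.eq_of_beq this.1, M5.eq_of_beq this.2, toMat_one]
  exact ⟨rfl, rfl⟩

theorem mem_pair {G : Gens} (h : okG G = true) {p : M5 × M5} (hp : p ∈ G) :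
    Mem (grp G) p.1 ∧ Mem (grp G) p.2 := by
  obtain ⟨h1, h2⟩ := okG_pair h hp
  let u : GL (Fin 5) ℤ := ⟨toMat p.1, toMat p.2, h1, h2⟩
  have hu : u ∈ grp G := Subgroup.subset_closure ⟨p, hp, rfl⟩
  exact ⟨⟨u, hu, rfl⟩, ⟨u⁻¹, (grp G).inv_mem hu, rfl⟩⟩

theorem mem_letters {G : Gens} {X : M5} (h : X ∈ letters G) : ∃ p ∈ G, X = p.1 ∨ X = p.2 := by
  induction G with
  | nil => simp [letters] at h
  | cons p l ih =>
    simp only [letters, List.mem_cons] at h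
    rcases h with h | h | h
    · exact ⟨p, by simp, Or.inl h⟩
    · exact ⟨p, by simp, Or.inr h⟩
    · obtain ⟨q, hq, hX⟩ := ih h
      exact ⟨q, by simp [hq], hX⟩

theorem letters_mem {G : Gens} (h : okG G = true) : ∀ X ∈ letters G, Mem (grp G) X := by
  intro X hX
  obtain ⟨p, hp, h1 | h1⟩ := mem_letters hX
  · rw [h1]; exact (mem_pair h hp).1
  · rw [h1]; exact (mem_pair h hp).2

/-! ### Coset tables -/

theorem relIndex_of_table (Γ : Subgroup (GL (Fin 5) ℤ)) (S : Set (GL (Fin 5) ℤ))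
    (R : Set (GL (Fin 5) ℤ)) (hR : R.Finite) (h1 : (1 : GL (Fin 5) ℤ) ∈ R)
    (h : ∀ r ∈ R, ∀ s ∈ S, ∃ r' ∈ R, ∃ w ∈ Γ, r * s = w * r') :
    Γ.relIndex (Subgroup.closure S) ≠ 0 := by
  -- finite set of left cosets, stable under left multiplication by inverses of generators
  let C : Set (GL (Fin 5) ℤ ⧸ Γ) := (fun r : GL (Fin 5) ℤ => ((r⁻¹ : GL (Fin 5) ℤ) : GL (Fin 5) ℤ ⧸ Γ)) '' R
  have hC : C.Finite := hR.image _
  have hstab : ∀ s ∈ S, ∀ c ∈ C, s⁻¹ • c ∈ C := by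
    rintro s hs _ ⟨r, hr, rfl⟩
    obtain ⟨r', hr', w, hw, e⟩ := h r hr s hs
    refine ⟨r', hr', ?_⟩
    change ((r'⁻¹ : GL (Fin 5) ℤ) : GL (Fin 5) ℤ ⧸ Γ) = ((s⁻¹ * r⁻¹ : GL (Fin 5) ℤ) : GL (Fin 5) ℤ ⧸ Γ)
    rw [QuotientGroup.eq, inv_inv, ← _root_.mul_inv_rev, e, _root_.mul_inv_rev, ← mul_assoc, mul_inv_cancel,
      one_mul]
    exact Γ.inv_mem hw
  have hstab' : ∀ s ∈ S, ∀ c ∈ C, s • c ∈ C := by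
    intro s hs c hc
    have hmaps : (fun c : GL (Fin 5) ℤ ⧸ Γ => s⁻¹ • c) '' C ⊆ C := by
      rintro _ ⟨c, hc, rfl⟩
      exact hstab s hs c hc
    have hcard : ((fun c : GL (Fin 5) ℤ ⧸ Γ => s⁻¹ • c) '' C).ncard = C.ncard :=
      Set.ncard_image_of_injective C (MulAction.injective s⁻¹)
    have hsurj : C ⊆ (fun c : GL (Fin 5) ℤ ⧸ Γ => s⁻¹ • c) '' C :=
      (Set.eq_of_subset_of_ncard_le hmaps hcard.ge hC).ge
    obtain ⟨d, hd, e⟩ := hsurj hc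
    have : s • c = d := by rw [← e]; simp
    rwa [this]
  have hall : ∀ g ∈ Subgroup.closure S, ∀ c ∈ C, g • c ∈ C := by
    intro g hg
    induction hg using Subgroup.closure_induction'' with
    | one => intro c hc; simpa using hc
    | mem x hx => exact hstab' x hx
    | inv_mem x hx => exact hstab x hx
    | mul x y _ _ hx hy => intro c hc; rw [mul_smul]; exact hx _ (hy _ hc)
  have hbase : ((1 : GL (Fin 5) ℤ) : GL (Fin 5) ℤ ⧸ Γ) ∈ C := ⟨1, h1, by simp⟩
  have : Finite C := hC
  let F : (Subgroup.closure S) ⧸ (Γ.subgroupOf (Subgroup.closure S)) → C :=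
    Quotient.lift (fun g : Subgroup.closure S => (⟨((g : GL (Fin 5) ℤ) : GL (Fin 5) ℤ ⧸ Γ), by
      have := hall g g.2 _ hbase
      simpa using this⟩ : C)) (by
        intro x y hxy
        have : x⁻¹ * y ∈ Γ.subgroupOf (Subgroup.closure S) := QuotientGroup.leftRel_apply.1 hxy
        apply Subtype.ext
        exact QuotientGroup.eq.2 this)
  have hF : Function.Injective F := by
    intro x y
    induction x using QuotientGroup.induction_on with | H x => ?_
    induction y using QuotientGroup.induction_on with | H y => ?_
    intro hxy
    have := congrArg Subtype.val hxy
    change ((x : GL (Fin 5) ℤ) : GL (Fin 5) ℤ ⧸ Γ) = ((y : GL (Fin 5) ℤ) : GL (Fin 5) ℤ ⧸ Γ) at this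
    rw [QuotientGroup.eq] at this ⊢
    exact this
  have : Finite ((Subgroup.closure S) ⧸ (Γ.subgroupOf (Subgroup.closure S))) :=
    Finite.of_injective F hF
  exact Subgroup.index_ne_zero_of_finite

/-- Representative number `i`, given by the list of words in the new generators. -/
def rep (T : Gens) (Rw : List (List ℕ)) (i : ℕ) : M5 := wprod (letters T) one (Rw.getD i [])

def check (G T : Gens) (Rw : List (List ℕ)) (tab : List (List (ℕ × List ℕ))) : Bool :=
  (List.range Rw.length).all fun i => (List.range T.length).all fun k =>
    decide (((tab.getD i []).getD k (0, [])).1 < Rw.length) &&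
    M5.beq (mul (rep T Rw i) (T.getD k (one, one)).1)
      (wprod (letters G) (rep T Rw ((tab.getD i []).getD k (0, [])).1)
        ((tab.getD i []).getD k (0, [])).2)

theorem step (G T : Gens) (Rw : List (List ℕ)) (tab : List (List (ℕ × List ℕ)))
    (hG : okG G = true) (hT : okG T = true) (hR : 0 < Rw.length) (hR0 : Rw.getD 0 [] = [])
    (hc : check G T Rw tab = true) : (grp G).relIndex (grp T) ≠ 0 := by
  refine relIndex_of_table (grp G) _ {g | ∃ i < Rw.length, (g : Mat) = toMat (rep T Rw i)} ?_ ?_ ?_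
  · have : ((fun g : GL (Fin 5) ℤ => (g : Mat)) ''
        {g | ∃ i < Rw.length, (g : Mat) = toMat (rep T Rw i)}).Finite := by
      refine (((Finset.range Rw.length).image fun i => toMat (rep T Rw i)).finite_toSet).subset ?_
      rintro _ ⟨g, ⟨i, hi, e⟩, rfl⟩
      simp only [Finset.coe_image, Set.mem_image, Finset.coe_range, Set.mem_Iio]
      exact ⟨i, hi, e.symm⟩
    exact this.of_finite_image (fun x _ y _ hxy => Units.ext hxy)
  · refine ⟨0, hR, ?_⟩
    rw [rep, hR0, wprod, toMat_one]
    rfl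
  · rintro r ⟨i, hi, er⟩ s ⟨p, hp, es⟩
    obtain ⟨k, hk, rfl⟩ := List.mem_iff_getElem.1 hp
    have h1 := List.all_eq_true.1 hc i (List.mem_range.2 hi)
    have h2 := List.all_eq_true.1 h1 k (List.mem_range.2 hk)
    rw [Bool.and_eq_true, decide_eq_true_eq] at h2
    obtain ⟨hj, hb⟩ := h2
    have hb := congrArg toMat (M5.eq_of_beq hb)
    rw [wprod_mul, toMat_mul, List.getD_eq_getElem _ _ hk, ← er, ← es] at hb
    obtain ⟨r', -, er'⟩ := Mem.wprod (letters_mem hT)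
      (Rw.getD (((tab.getD i []).getD k (0, [])).1) [])
    obtain ⟨w, hw, ew⟩ := Mem.wprod (letters_mem hG) ((tab.getD i []).getD k (0, [])).2
    refine ⟨r', ⟨_, hj, er'⟩, w, hw, Units.ext ?_⟩
    change (r : Mat) * (s : Mat) = (w : Mat) * (r' : Mat)
    rw [hb, ew, er']
    rfl

/-! ### The matrices of the chain of groups -/

def mN : M5 × M5 :=
  (⟨⟨-1, 0, 0, 0, 0⟩, ⟨0, -1, 0, 0, 0⟩, ⟨0, 0, -1, 0, 0⟩, ⟨0, 0, 0, -1, 0⟩, ⟨0, 0, 0, 0, -1⟩⟩,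
   ⟨⟨-1, 0, 0, 0, 0⟩, ⟨0, -1, 0, 0, 0⟩, ⟨0, 0, -1, 0, 0⟩, ⟨0, 0, 0, -1, 0⟩, ⟨0, 0, 0, 0, -1⟩⟩)

def mA : M5 × M5 :=
  (⟨⟨-2, -3, 2, 3, -4⟩, ⟨1, 1, -2, -1, 0⟩, ⟨-1, -2, 1, 1, -2⟩, ⟨-1, -1, 0, 1, -1⟩, ⟨0, 1, 0, 0, 1⟩⟩,
   ⟨⟨1, -1, -4, 0, -4⟩, ⟨0, 1, 2, -1, 3⟩, ⟨0, 0, 1, -1, 1⟩, ⟨1, -1, -4, 1, -3⟩, ⟨0, -1, -2, 1, -2⟩⟩)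

def mB : M5 × M5 :=
  (⟨⟨-1, -1, 0, 2, -2⟩, ⟨0, -1, 0, 0, -2⟩, ⟨0, 0, -1, 0, 0⟩, ⟨-1, -1, 0, 1, -1⟩, ⟨0, 1, 0, 0, 1⟩⟩,
   ⟨⟨1, -1, 0, -2, -2⟩, ⟨0, 1, 0, 0, 2⟩, ⟨0, 0, -1, 0, 0⟩, ⟨1, -1, 0, -1, -1⟩, ⟨0, -1, 0, 0, -1⟩⟩)

def mC : M5 × M5 :=
  (⟨⟨-1, -4, 4, 2, -4⟩, ⟨1, 3, -2, -1, 2⟩, ⟨1, 2, -1, -1, 2⟩, ⟨-2, -4, 4, 3, -4⟩, ⟨-1, -2, 2, 1, -1⟩⟩,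
   ⟨⟨-1, -4, 4, 2, -4⟩, ⟨1, 3, -2, -1, 2⟩, ⟨1, 2, -1, -1, 2⟩, ⟨-2, -4, 4, 3, -4⟩, ⟨-1, -2, 2, 1, -1⟩⟩)

def mx1 : M5 × M5 :=
  (⟨⟨-3, 0, 0, 4, 0⟩, ⟨0, -3, 0, 0, -4⟩, ⟨0, 0, 1, 0, 0⟩, ⟨-4, 0, 0, 5, 0⟩, ⟨0, 4, 0, 0, 5⟩⟩,
   ⟨⟨5, 0, 0, -4, 0⟩, ⟨0, 5, 0, 0, 4⟩, ⟨0, 0, 1, 0, 0⟩, ⟨4, 0, 0, -3, 0⟩, ⟨0, -4, 0, 0, -3⟩⟩)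

def mx2 : M5 × M5 :=
  (⟨⟨-1, 0, 0, 2, 0⟩, ⟨0, -1, 0, 0, -2⟩, ⟨0, 0, 1, 0, 0⟩, ⟨-2, 0, 0, 3, 0⟩, ⟨0, 2, 0, 0, 3⟩⟩,
   ⟨⟨3, 0, 0, -2, 0⟩, ⟨0, 3, 0, 0, 2⟩, ⟨0, 0, 1, 0, 0⟩, ⟨2, 0, 0, -1, 0⟩, ⟨0, -2, 0, 0, -1⟩⟩)

def mx3 : M5 × M5 :=
  (⟨⟨1, -2, 0, 0, 0⟩, ⟨0, 1, 0, 0, 0⟩, ⟨0, 2, 1, 0, 0⟩, ⟨-2, 0, -4, 1, 2⟩, ⟨0, 2, 0, 0, 1⟩⟩,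
   ⟨⟨1, 2, 0, 0, 0⟩, ⟨0, 1, 0, 0, 0⟩, ⟨0, -2, 1, 0, 0⟩, ⟨2, 0, 4, 1, -2⟩, ⟨0, -2, 0, 0, 1⟩⟩)

def mx4 : M5 × M5 :=
  (⟨⟨1, 0, 0, 0, 0⟩, ⟨0, 1, 0, 0, 0⟩, ⟨0, 0, 1, 0, 0⟩, ⟨-2, 0, 0, 1, 0⟩, ⟨0, 2, 0, 0, 1⟩⟩,
   ⟨⟨1, 0, 0, 0, 0⟩, ⟨0, 1, 0, 0, 0⟩, ⟨0, 0, 1, 0, 0⟩, ⟨2, 0, 0, 1, 0⟩, ⟨0, -2, 0, 0, 1⟩⟩)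

def mx5 : M5 × M5 :=
  (⟨⟨1, 0, 0, 0, 0⟩, ⟨0, 1, 2, -1, 0⟩, ⟨0, 0, 1, -1, 0⟩, ⟨0, 0, 0, 1, 0⟩, ⟨0, 0, 0, 0, 1⟩⟩,
   ⟨⟨1, 0, 0, 0, 0⟩, ⟨0, 1, -2, -1, 0⟩, ⟨0, 0, 1, 1, 0⟩, ⟨0, 0, 0, 1, 0⟩, ⟨0, 0, 0, 0, 1⟩⟩)

def mx6 : M5 × M5 :=
  (⟨⟨1, 0, 0, 0, 0⟩, ⟨0, 1, 0, 0, 0⟩, ⟨0, 0, 1, 0, 0⟩, ⟨-1, 0, 0, 1, 0⟩, ⟨0, 1, 0, 0, 1⟩⟩,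
   ⟨⟨1, 0, 0, 0, 0⟩, ⟨0, 1, 0, 0, 0⟩, ⟨0, 0, 1, 0, 0⟩, ⟨1, 0, 0, 1, 0⟩, ⟨0, -1, 0, 0, 1⟩⟩)

def mx7 : M5 × M5 :=
  (⟨⟨0, 0, 0, 1, 0⟩, ⟨0, 0, 0, 0, -1⟩, ⟨0, 0, 1, 0, 0⟩, ⟨-1, 0, 0, 2, 0⟩, ⟨0, 1, 0, 0, 2⟩⟩,
   ⟨⟨2, 0, 0, -1, 0⟩, ⟨0, 2, 0, 0, 1⟩, ⟨0, 0, 1, 0, 0⟩, ⟨1, 0, 0, 0, 0⟩, ⟨0, -1, 0, 0, 0⟩⟩)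

def ms12 : M5 × M5 :=
  (⟨⟨0, 1, 0, 0, 0⟩, ⟨1, 0, 0, 0, 0⟩, ⟨0, 0, 1, 0, 0⟩, ⟨0, 0, 0, 0, 1⟩, ⟨0, 0, 0, 1, 0⟩⟩,
   ⟨⟨0, 1, 0, 0, 0⟩, ⟨1, 0, 0, 0, 0⟩, ⟨0, 0, 1, 0, 0⟩, ⟨0, 0, 0, 0, 1⟩, ⟨0, 0, 0, 1, 0⟩⟩)

def mt1 : M5 × M5 :=
  (⟨⟨0, 0, 0, 0, 1⟩, ⟨0, 1, 0, 0, 0⟩, ⟨0, 0, 1, 0, 0⟩, ⟨0, 0, 0, 1, 0⟩, ⟨1, 0, 0, 0, 0⟩⟩,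
   ⟨⟨0, 0, 0, 0, 1⟩, ⟨0, 1, 0, 0, 0⟩, ⟨0, 0, 1, 0, 0⟩, ⟨0, 0, 0, 1, 0⟩, ⟨1, 0, 0, 0, 0⟩⟩)

def mn1 : M5 × M5 :=
  (⟨⟨-1, 0, 0, 0, 0⟩, ⟨0, 1, 0, 0, 0⟩, ⟨0, 0, 1, 0, 0⟩, ⟨0, 0, 0, 1, 0⟩, ⟨0, 0, 0, 0, -1⟩⟩,
   ⟨⟨-1, 0, 0, 0, 0⟩, ⟨0, 1, 0, 0, 0⟩, ⟨0, 0, 1, 0, 0⟩, ⟨0, 0, 0, 1, 0⟩, ⟨0, 0, 0, 0, -1⟩⟩)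

def mnw : M5 × M5 :=
  (⟨⟨1, 0, 0, 0, 0⟩, ⟨0, 1, 0, 0, 0⟩, ⟨0, 0, -1, 0, 0⟩, ⟨0, 0, 0, 1, 0⟩, ⟨0, 0, 0, 0, 1⟩⟩,
   ⟨⟨1, 0, 0, 0, 0⟩, ⟨0, 1, 0, 0, 0⟩, ⟨0, 0, -1, 0, 0⟩, ⟨0, 0, 0, 1, 0⟩, ⟨0, 0, 0, 0, 1⟩⟩)

def mEx : M5 × M5 :=
  (⟨⟨1, 0, 0, 0, 0⟩, ⟨1, 1, 0, 0, 0⟩, ⟨0, 0, 1, 0, 0⟩, ⟨0, 0, 0, 1, 0⟩, ⟨0, 0, 0, -1, 1⟩⟩,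
   ⟨⟨1, 0, 0, 0, 0⟩, ⟨-1, 1, 0, 0, 0⟩, ⟨0, 0, 1, 0, 0⟩, ⟨0, 0, 0, 1, 0⟩, ⟨0, 0, 0, 1, 1⟩⟩)

def mEw : M5 × M5 :=
  (⟨⟨1, 0, 0, 0, 0⟩, ⟨0, 1, 0, 0, 0⟩, ⟨1, 0, 1, 0, 0⟩, ⟨0, 0, 0, 1, 0⟩, ⟨-1, 0, -2, 0, 1⟩⟩,
   ⟨⟨1, 0, 0, 0, 0⟩, ⟨0, 1, 0, 0, 0⟩, ⟨-1, 0, 1, 0, 0⟩, ⟨0, 0, 0, 1, 0⟩, ⟨-1, 0, 2, 0, 1⟩⟩)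

def G0 : Gens := [mA, mB]

def G1 : Gens := [mN, mA, mC]

def G2 : Gens := [mN, mA, mC, mx1]

def G3 : Gens := [mN, mA, mC, mx2]

def G4 : Gens := [mN, mA, mC, mx2, mx3]

def G5 : Gens := [mN, mA, mC, mx2, mx3, mx4]

def G6 : Gens := [mN, mA, mC, mx2, mx3, mx4, mx5]

def G7 : Gens := [mN, mA, mC, mx2, mx3, mx5, mx6]

def G8 : Gens := [mN, mA, mC, mx3, mx5, mx6, mx7]

def G9 : Gens := [ms12, mt1, mn1, mnw, mEx, mEw]

def tab0 : List (List (ℕ × List ℕ)) :=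
  [[(1, []),
    (0, [0]),
    (0, [1, 2])],
   [(0, []),
    (1, [0]),
    (1, [1, 2])]]

theorem step0 : (grp G0).relIndex (grp G1) ≠ 0 :=
  step G0 G1 [[], [0]] tab0
    (by decide +kernel) (by decide +kernel) (by decide) rfl (by decide +kernel)

def tab1 : List (List (ℕ × List ℕ)) :=
  [[(0, [0]),
    (0, [2]),
    (0, [4]),
    (1, [])],
   [(1, [0]),
    (1, [3, 4, 2, 4, 2, 4, 2, 4, 3, 4, 3, 4, 3, 3, 3, 3, 3, 3, 4, 3, 4, 3, 4, 3, 4, 2, 4, 2, 4, 2, 2, 4, 3, 4, 3, 4, 3, 4, 3, 4, 3, 4, 3]),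
    (1, [4]),
    (0, [4, 3, 4, 3, 4, 3, 4, 3, 4, 2, 4, 2, 4, 2, 4, 2, 4, 2, 4, 2, 4, 3, 4, 3, 4, 3, 4, 3, 4, 2, 4, 2])]]

theorem step1 : (grp G1).relIndex (grp G2) ≠ 0 :=
  step G1 G2 [[], [6]] tab1
    (by decide +kernel) (by decide +kernel) (by decide) rfl (by decide +kernel)

def tab2 : List (List (ℕ × List ℕ)) :=
  [[(0, [0]),
    (0, [2]),
    (0, [4]),
    (1, [])],
   [(1, [0]),
    (1, [2, 2, 4, 3, 4, 3, 6, 4, 2, 2, 2, 4, 3, 4, 3, 6, 4, 2, 2, 7]),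
    (1, [4]),
    (0, [6])]]

theorem step2 : (grp G2).relIndex (grp G3) ≠ 0 :=
  step G2 G3 [[], [6]] tab2
    (by decide +kernel) (by decide +kernel) (by decide) rfl (by decide +kernel)

def tab3 : List (List (ℕ × List ℕ)) :=
  [[(0, [0]),
    (0, [2]),
    (0, [4]),
    (0, [6]),
    (1, [])],
   [(1, [0]),
    (2, []),
    (2, [4, 3, 7, 4, 3, 4, 2, 2, 7, 4, 2, 2, 6, 6, 4, 3]),
    (1, [4, 3, 4, 2, 2, 7, 4, 2, 2, 6, 6, 4, 3]),
    (0, [4, 3, 4, 2, 6, 2, 2, 2, 6, 2, 2, 7, 3, 7])],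
   [(2, [0]),
    (3, []),
    (1, [2, 7, 7, 4, 3, 3, 6, 4, 3, 3, 4, 2, 6, 4, 2, 4]),
    (2, [4, 3, 7, 4, 3, 4, 2, 2, 7, 4, 2, 2, 6, 6, 2, 6, 3]),
    (3, [2, 7, 3, 7, 4, 3, 7, 2, 6, 3, 4, 6, 2, 2, 2, 4, 6, 6, 6, 3, 4, 2, 4, 2, 4])],
   [(3, [0]),
    (1, [4, 3, 4, 2, 6, 2, 6, 4, 2, 2, 2, 4, 2, 4, 3, 7, 3, 7, 4]),
    (3, [4, 3, 4, 2, 6, 4, 3, 6, 4, 3, 4, 2, 7, 4, 2, 7, 4, 3, 4, 2, 4]),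
    (3, [6, 4, 2, 6, 2, 4, 3, 3, 6, 2, 2, 4, 3, 7, 3, 4, 7]),
    (2, [2, 7, 3, 7, 4, 2, 7, 3, 3, 7, 3, 4, 3, 7, 4, 3, 3, 7, 3, 7, 4, 2, 2, 6, 2])]]

theorem step3 : (grp G3).relIndex (grp G4) ≠ 0 :=
  step G3 G4 [[], [8], [8, 2], [8, 2, 2]] tab3
    (by decide +kernel) (by decide +kernel) (by decide) rfl (by decide +kernel)

def tab4 : List (List (ℕ × List ℕ)) :=
  [[(0, [0]),
    (0, [2]),
    (0, [4]),
    (0, [6]),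
    (0, [8]),
    (1, [])],
   [(1, [0]),
    (1, [2, 7, 4, 2, 4, 3, 8, 4, 3, 6, 4, 2]),
    (1, [8, 2, 4, 2, 4, 3, 4, 3, 9]),
    (1, [2, 7, 3, 6, 2, 6, 3]),
    (1, [8]),
    (0, [2, 7, 3, 7, 2, 7, 3, 7])]]

theorem step4 : (grp G4).relIndex (grp G5) ≠ 0 :=
  step G4 G5 [[], [10]] tab4
    (by decide +kernel) (by decide +kernel) (by decide) rfl (by decide +kernel)

def tab5 : List (List (ℕ × List ℕ)) :=
  [[(0, [0]),
    (0, [2]),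
    (0, [4]),
    (0, [6]),
    (0, [8]),
    (0, [10]),
    (1, [])],
   [(1, [0]),
    (2, []),
    (1, [7, 9, 6, 2, 11, 3, 4, 2, 10, 4, 8, 4, 3]),
    (1, [10, 3, 3, 8, 2, 2, 11]),
    (1, [10, 2, 2, 6, 3, 3, 11]),
    (1, [2, 7, 4, 9, 4, 11, 3, 7]),
    (0, [2, 6, 4, 10, 9, 4, 11, 8, 3])],
   [(2, [0]),
    (1, [7, 9, 9, 2, 4, 9, 2, 7, 4, 2, 2, 8, 6]),
    (2, [10, 2, 7, 8, 4, 9, 6, 3, 11]),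
    (2, [2, 6, 3]),
    (2, [7, 11, 6, 10, 6]),
    (2, [4, 3, 3, 3, 10, 2, 2, 2, 4]),
    (2, [2, 10, 6, 2, 11, 7, 9, 4, 3, 4])]]

theorem step5 : (grp G5).relIndex (grp G6) ≠ 0 :=
  step G5 G6 [[], [12], [12, 2]] tab5
    (by decide +kernel) (by decide +kernel) (by decide) rfl (by decide +kernel)

def tab6 : List (List (ℕ × List ℕ)) :=
  [[(0, [0]),
    (0, [2]),
    (0, [4]),
    (0, [6]),
    (0, [8]),
    (0, [12]),
    (1, [])],
   [(1, [0]),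
    (1, [0, 4, 3, 4, 7, 7, 11, 8, 13, 4]),
    (1, [0, 6, 2, 11, 3, 7, 12, 9]),
    (1, [2, 6, 3]),
    (1, [8]),
    (1, [0, 2, 7, 3, 3, 13, 13, 2, 4, 11]),
    (0, [10])]]

theorem step6 : (grp G6).relIndex (grp G7) ≠ 0 :=
  step G6 G7 [[], [12]] tab6
    (by decide +kernel) (by decide +kernel) (by decide) rfl (by decide +kernel)

def tab7 : List (List (ℕ × List ℕ)) :=
  [[(0, [0]),
    (0, [2]),
    (0, [4]),
    (0, [8]),
    (0, [10]),
    (0, [12]),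
    (1, [])],
   [(1, [0]),
    (2, []),
    (1, [4]),
    (1, [0, 9, 4, 13, 10, 12]),
    (3, []),
    (4, []),
    (0, [6])],
   [(2, [0]),
    (5, []),
    (4, [12, 2, 7, 4]),
    (2, [10, 12, 2, 6, 3, 13, 11]),
    (2, [2, 10, 12, 4, 11, 4, 10, 13, 3]),
    (3, [0, 12, 4, 6, 3, 10, 7, 11, 9]),
    (2, [12])],
   [(3, [0]),
    (6, []),
    (3, [0, 8, 7, 13, 7, 11, 13, 9]),
    (3, [13, 4, 8, 4, 12]),
    (1, [11, 12, 10, 10, 13, 11]),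
    (2, [0, 13, 4, 8, 3, 12, 11, 6, 10, 6, 13]),
    (7, [])],
   [(4, [0]),
    (1, [13, 6, 2]),
    (2, [13, 6, 4, 3]),
    (4, [0, 9, 4, 13, 10, 12]),
    (4, [13, 6, 10, 7, 12]),
    (1, [13, 6, 12]),
    (4, [12])],
   [(5, [0]),
    (7, [3, 7, 3, 3, 13, 11, 12, 11, 9]),
    (8, []),
    (5, [13, 2, 10, 4, 12, 12, 4, 11, 3, 12]),
    (9, []),
    (5, [13, 3, 3, 12, 2, 2, 12]),
    (8, [0, 13, 2, 12, 2, 2, 2, 12, 12])],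
   [(6, [0]),
    (9, [0, 10, 12, 12, 9, 7, 13, 3, 8, 2, 7, 4, 12]),
    (9, [0, 10, 2, 4, 11, 2, 13, 4, 2, 6, 2, 12]),
    (6, [12, 2, 6, 3, 13]),
    (8, [10, 10, 13, 2, 4, 3, 11, 13]),
    (6, [3, 11, 7, 13, 13, 13, 9]),
    (6, [12])],
   [(7, [0]),
    (8, [0, 10, 2, 2, 6, 2]),
    (7, [0, 8, 7, 13, 7, 11, 13, 9]),
    (7, [0, 4, 13, 8, 4, 12, 6, 11, 7, 9, 9, 4]),
    (7, [10, 13, 11, 11, 12]),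
    (7, [6, 10, 10, 12, 11, 11, 7]),
    (3, [10, 6, 11])],
   [(8, [0]),
    (4, [0, 4, 3, 11, 3, 11, 11, 2, 12, 4]),
    (5, []),
    (8, [11, 6, 10]),
    (6, [13, 8, 6, 4, 3, 9, 7, 13, 10, 2]),
    (9, [11, 7, 13, 10, 10, 4, 8, 6, 10, 2]),
    (5, [0, 13, 2, 12, 2, 2, 2, 12, 12])],
   [(9, [0]),
    (3, [3, 7, 3, 4, 10, 4, 3, 11, 9]),
    (6, [2, 12, 2, 10, 12, 7, 4, 3, 6, 11, 7]),
    (9, [3, 7, 3, 6, 2, 6, 2]),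
    (5, [0, 13, 3, 3, 3, 6, 13, 2, 13, 10, 4, 2, 2, 12]),
    (8, [0, 3, 3, 12, 2, 6, 11, 12, 6, 12]),
    (9, [3, 3, 10, 4, 12, 4, 11, 2, 2])]]

theorem step7 : (grp G7).relIndex (grp G8) ≠ 0 :=
  step G7 G8 [[], [12], [12, 2], [12, 8], [12, 10], [12, 2, 2], [12, 8, 2], [12, 8, 12], [12, 2, 2, 4], [12, 2, 2, 8]] tab7
    (by decide +kernel) (by decide +kernel) (by decide) rfl (by decide +kernel)

def tab8 : List (List (ℕ × List ℕ)) :=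
  [[(1, [0, 9, 12, 8, 3, 10, 9, 4, 12, 8]),
    (1, [10, 8, 11, 2, 4, 3, 10, 9, 11]),
    (1, []),
    (0, [0, 12, 10, 10, 12, 10, 10]),
    (0, [9, 12, 8, 13, 11, 8, 10]),
    (0, [12, 9, 13])],
   [(0, [0, 9, 13, 4, 8, 11, 2, 9, 13, 8]),
    (0, [10, 8, 11, 2, 4, 3, 10, 9, 11]),
    (0, []),
    (1, [0, 12, 10, 10, 12, 10, 10]),
    (1, [9, 12, 9, 13, 10, 8, 11]),
    (1, [12, 8, 13])]]

theorem step8 : (grp G8).relIndex (grp G9) ≠ 0 :=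
  step G8 G9 [[], [4]] tab8
    (by decide +kernel) (by decide +kernel) (by decide) rfl (by decide +kernel)

theorem chain_finite : (grp G0).relIndex (grp G9) ≠ 0 :=
  Subgroup.relIndex_ne_zero_trans (Subgroup.relIndex_ne_zero_trans (Subgroup.relIndex_ne_zero_trans (Subgroup.relIndex_ne_zero_trans (Subgroup.relIndex_ne_zero_trans (Subgroup.relIndex_ne_zero_trans (Subgroup.relIndex_ne_zero_trans (Subgroup.relIndex_ne_zero_trans (step0) step1) step2) step3) step4) step5) step6) step7) step8

/-! ### The orthogonal group of `x₁y₁ + x₂y₂ + w²` is generated by `G9` -/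

/-- `H` moves `v` to `u`. -/
def Orb (H : Subgroup (GL (Fin 5) ℤ)) (v u : Fin 5 → ℤ) : Prop :=
  ∃ h ∈ H, (h : Mat) *ᵥ v = u

theorem Orb.refl (H : Subgroup (GL (Fin 5) ℤ)) (v : Fin 5 → ℤ) : Orb H v v :=
  ⟨1, H.one_mem, by simp⟩

theorem Orb.trans {H : Subgroup (GL (Fin 5) ℤ)} {u v w : Fin 5 → ℤ} (h1 : Orb H u v)
    (h2 : Orb H v w) : Orb H u w := by
  obtain ⟨g, hg, rfl⟩ := h1
  obtain ⟨k, hk, rfl⟩ := h2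
  exact ⟨k * g, H.mul_mem hk hg, by simp [Matrix.mulVec_mulVec]⟩

theorem Orb.symm {H : Subgroup (GL (Fin 5) ℤ)} {u v : Fin 5 → ℤ} (h1 : Orb H u v) :
    Orb H v u := by
  obtain ⟨g, hg, rfl⟩ := h1
  refine ⟨g⁻¹, H.inv_mem hg, ?_⟩
  rw [Matrix.mulVec_mulVec, ← Units.val_mul, inv_mul_cancel, Units.val_one, Matrix.one_mulVec]

/-- If one step moves `p k` to `p (k+1)`, then `p 0` moves to every `p k`. -/
theorem Orb.iter {H : Subgroup (GL (Fin 5) ℤ)} (p : ℤ → Fin 5 → ℤ)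
    (h : ∀ k, Orb H (p k) (p (k + 1))) (k : ℤ) : Orb H (p 0) (p k) := by
  induction k using Int.induction_on with
  | zero => exact Orb.refl H _
  | succ i ih => exact ih.trans (h _)
  | pred i ih =>
    have := h (-(i : ℤ) - 1)
    rw [sub_add_cancel] at this
    exact ih.trans this.symm

theorem g9_ok : okG G9 = true := by decide +kernel

/-- The generated group. -/
def K : Subgroup (GL (Fin 5) ℤ) := grp G9

theorem memK {X : M5 × M5} (h : X ∈ G9) : Mem K X.1 := (mem_pair g9_ok h).1

theorem memK_s12 : Mem K ms12.1 := memK (by simp [G9])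
theorem memK_t1 : Mem K mt1.1 := memK (by simp [G9])
theorem memK_n1 : Mem K mn1.1 := memK (by simp [G9])
theorem memK_nw : Mem K mnw.1 := memK (by simp [G9])
theorem memK_Ex : Mem K mEx.1 := memK (by simp [G9])
theorem memK_Ew : Mem K mEw.1 := memK (by simp [G9])

/-- Subgroup fixing a vector. -/
def fixV (v : Fin 5 → ℤ) : Subgroup (GL (Fin 5) ℤ) where
  carrier := {g | (g : Mat) *ᵥ v = v}
  one_mem' := by change (1 : Mat) *ᵥ v = v; simp
  mul_mem' := by
    intro a b ha hb
    change ((a : Mat) * (b : Mat)) *ᵥ v = v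
    rw [← Matrix.mulVec_mulVec]
    exact (congrArg _ hb).trans ha
  inv_mem' := by
    intro a ha
    have ha : (a : Mat) *ᵥ v = v := ha
    change ((a⁻¹ : GL (Fin 5) ℤ) : Mat) *ᵥ v = v
    conv_lhs => rw [← ha]
    rw [Matrix.mulVec_mulVec, ← Units.val_mul, inv_mul_cancel, Units.val_one, Matrix.one_mulVec]

def e1 : Fin 5 → ℤ := ![1, 0, 0, 0, 0]
def e2 : Fin 5 → ℤ := ![0, 1, 0, 0, 0]
def ew : Fin 5 → ℤ := ![0, 0, 1, 0, 0]
def f2 : Fin 5 → ℤ := ![0, 0, 0, 1, 0]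
def f1 : Fin 5 → ℤ := ![0, 0, 0, 0, 1]

theorem toMat_mulVec (X : M5) (a b c d e : ℤ) : toMat X *ᵥ ![a, b, c, d, e] =
    ![X.r0.a * a + X.r0.b * b + X.r0.c * c + X.r0.d * d + X.r0.e * e,
      X.r1.a * a + X.r1.b * b + X.r1.c * c + X.r1.d * d + X.r1.e * e,
      X.r2.a * a + X.r2.b * b + X.r2.c * c + X.r2.d * d + X.r2.e * e,
      X.r3.a * a + X.r3.b * b + X.r3.c * c + X.r3.d * d + X.r3.e * e,
      X.r4.a * a + X.r4.b * b + X.r4.c * c + X.r4.d * d + X.r4.e * e] := by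
  ext i
  fin_cases i <;> simp [toMat, R5.vec, Matrix.mulVec, dotProduct, Fin.sum_univ_succ] <;> ring

theorem orb_of_mem {H : Subgroup (GL (Fin 5) ℤ)} {X : M5} (h : Mem H X) (v u : Fin 5 → ℤ)
    (e : toMat X *ᵥ v = u) : Orb H v u := by
  obtain ⟨g, hg, hX⟩ := h
  exact ⟨g, hg, by rw [hX, e]⟩

theorem mem_fix {H : Subgroup (GL (Fin 5) ℤ)} {X : M5} (h : Mem H X) (v : Fin 5 → ℤ)
    (e : toMat X *ᵥ v = v) : Mem (H ⊓ fixV v) X := by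
  obtain ⟨g, hg, hX⟩ := h
  refine ⟨g, ⟨hg, ?_⟩, hX⟩
  change (g : Mat) *ᵥ v = v
  rw [hX, e]

/-- Composite elements. -/
def t2 : M5 := mul ms12.1 (mul mt1.1 ms12.1)
def n2 : M5 := mul ms12.1 (mul mn1.1 ms12.1)
def Ey : M5 := mul t2 (mul mEx.1 t2)
def Fx : M5 := mul mt1.1 (mul mEx.1 mt1.1)
def Fy : M5 := mul mt1.1 (mul Ey mt1.1)
def Fw : M5 := mul mt1.1 (mul mEw.1 mt1.1)
def Gw : M5 := mul ms12.1 (mul mEw.1 ms12.1)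
def Hw : M5 := mul t2 (mul Gw t2)

theorem memK_t2 : Mem K t2 := memK_s12.mul (memK_t1.mul memK_s12)
theorem memK_n2 : Mem K n2 := memK_s12.mul (memK_n1.mul memK_s12)
theorem memK_Ey : Mem K Ey := memK_t2.mul (memK_Ex.mul memK_t2)
theorem memK_Fx : Mem K Fx := memK_t1.mul (memK_Ex.mul memK_t1)
theorem memK_Fy : Mem K Fy := memK_t1.mul (memK_Ey.mul memK_t1)
theorem memK_Fw : Mem K Fw := memK_t1.mul (memK_Ew.mul memK_t1)
theorem memK_Gw : Mem K Gw := memK_s12.mul (memK_Ew.mul memK_s12)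
theorem memK_Hw : Mem K Hw := memK_t2.mul (memK_Gw.mul memK_t2)

section action
variable (x1 x2 w y2 y1 : ℤ)

theorem act_s12 : toMat ms12.1 *ᵥ ![x1, x2, w, y2, y1] = ![x2, x1, w, y1, y2] := by
  rw [toMat_mulVec]; simp [ms12]
theorem act_t1 : toMat mt1.1 *ᵥ ![x1, x2, w, y2, y1] = ![y1, x2, w, y2, x1] := by
  rw [toMat_mulVec]; simp [mt1]
theorem act_n1 : toMat mn1.1 *ᵥ ![x1, x2, w, y2, y1] = ![-x1, x2, w, y2, -y1] := by
  rw [toMat_mulVec]; simp [mn1]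
theorem act_nw : toMat mnw.1 *ᵥ ![x1, x2, w, y2, y1] = ![x1, x2, -w, y2, y1] := by
  rw [toMat_mulVec]; simp [mnw]
theorem act_Ex : toMat mEx.1 *ᵥ ![x1, x2, w, y2, y1] = ![x1, x2 + x1, w, y2, y1 - y2] := by
  rw [toMat_mulVec]; simp [mEx]; constructor <;> ring
theorem act_Ew :
    toMat mEw.1 *ᵥ ![x1, x2, w, y2, y1] = ![x1, x2, w + x1, y2, y1 - 2 * w - x1] := by
  rw [toMat_mulVec]; simp [mEw]; constructor <;> ring
theorem act_t2 : toMat t2 *ᵥ ![x1, x2, w, y2, y1] = ![x1, y2, w, x2, y1] := by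
  simp only [t2, toMat_mul, ← Matrix.mulVec_mulVec, act_s12, act_t1]
theorem act_n2 : toMat n2 *ᵥ ![x1, x2, w, y2, y1] = ![x1, -x2, w, -y2, y1] := by
  simp only [n2, toMat_mul, ← Matrix.mulVec_mulVec, act_s12, act_n1]
theorem act_Ey : toMat Ey *ᵥ ![x1, x2, w, y2, y1] = ![x1, x2, w, y2 + x1, y1 - x2] := by
  simp only [Ey, toMat_mul, ← Matrix.mulVec_mulVec, act_t2, act_Ex]
theorem act_Fx : toMat Fx *ᵥ ![x1, x2, w, y2, y1] = ![x1 - y2, x2 + y1, w, y2, y1] := by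
  simp only [Fx, toMat_mul, ← Matrix.mulVec_mulVec, act_t1, act_Ex]
theorem act_Fy : toMat Fy *ᵥ ![x1, x2, w, y2, y1] = ![x1 - x2, x2, w, y2 + y1, y1] := by
  simp only [Fy, toMat_mul, ← Matrix.mulVec_mulVec, act_t1, act_Ey]
theorem act_Fw :
    toMat Fw *ᵥ ![x1, x2, w, y2, y1] = ![x1 - 2 * w - y1, x2, w + y1, y2, y1] := by
  simp only [Fw, toMat_mul, ← Matrix.mulVec_mulVec, act_t1, act_Ew]
theorem act_Gw :
    toMat Gw *ᵥ ![x1, x2, w, y2, y1] = ![x1, x2, w + x2, y2 - 2 * w - x2, y1] := by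
  simp only [Gw, toMat_mul, ← Matrix.mulVec_mulVec, act_s12, act_Ew]
theorem act_Hw :
    toMat Hw *ᵥ ![x1, x2, w, y2, y1] = ![x1, x2 - 2 * w - y2, w + y2, y2, y1] := by
  simp only [Hw, toMat_mul, ← Matrix.mulVec_mulVec, act_t2, act_Gw]

end action

theorem vec_congr {a b c d e a' b' c' d' e' : ℤ} (h1 : a = a') (h2 : b = b') (h3 : c = c')
    (h4 : d = d') (h5 : e = e') : (![a, b, c, d, e] : Fin 5 → ℤ) = ![a', b', c', d', e'] := by
  rw [h1, h2, h3, h4, h5]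

section iterates
variable {H : Subgroup (GL (Fin 5) ℤ)} (x1 x2 w y2 y1 k : ℤ)

theorem orb_Ex (h : Mem H mEx.1) :
    Orb H ![x1, x2, w, y2, y1] ![x1, x2 + k * x1, w, y2, y1 - k * y2] := by
  have := Orb.iter (H := H) (fun k => ![x1, x2 + k * x1, w, y2, y1 - k * y2]) (fun k =>
    orb_of_mem h _ _ (by rw [act_Ex]; apply vec_congr <;> ring)) k
  simpa using this

theorem orb_Ey (h : Mem H Ey) :
    Orb H ![x1, x2, w, y2, y1] ![x1, x2, w, y2 + k * x1, y1 - k * x2] := by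
  have := Orb.iter (H := H) (fun k => ![x1, x2, w, y2 + k * x1, y1 - k * x2]) (fun k =>
    orb_of_mem h _ _ (by rw [act_Ey]; apply vec_congr <;> ring)) k
  simpa using this

theorem orb_Ew (h : Mem H mEw.1) : Orb H ![x1, x2, w, y2, y1]
    ![x1, x2, w + k * x1, y2, y1 - 2 * k * w - k ^ 2 * x1] := by
  have := Orb.iter (H := H) (fun k => ![x1, x2, w + k * x1, y2, y1 - 2 * k * w - k ^ 2 * x1])
    (fun k => orb_of_mem h _ _ (by rw [act_Ew]; apply vec_congr <;> ring)) k
  simpa using this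

theorem orb_Fx (h : Mem H Fx) :
    Orb H ![x1, x2, w, y2, y1] ![x1 - k * y2, x2 + k * y1, w, y2, y1] := by
  have := Orb.iter (H := H) (fun k => ![x1 - k * y2, x2 + k * y1, w, y2, y1]) (fun k =>
    orb_of_mem h _ _ (by rw [act_Fx]; apply vec_congr <;> ring)) k
  simpa using this

theorem orb_Fy (h : Mem H Fy) :
    Orb H ![x1, x2, w, y2, y1] ![x1 - k * x2, x2, w, y2 + k * y1, y1] := by
  have := Orb.iter (H := H) (fun k => ![x1 - k * x2, x2, w, y2 + k * y1, y1]) (fun k =>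
    orb_of_mem h _ _ (by rw [act_Fy]; apply vec_congr <;> ring)) k
  simpa using this

theorem orb_Fw (h : Mem H Fw) : Orb H ![x1, x2, w, y2, y1]
    ![x1 - 2 * k * w - k ^ 2 * y1, x2, w + k * y1, y2, y1] := by
  have := Orb.iter (H := H) (fun k => ![x1 - 2 * k * w - k ^ 2 * y1, x2, w + k * y1, y2, y1])
    (fun k => orb_of_mem h _ _ (by rw [act_Fw]; apply vec_congr <;> ring)) k
  simpa using this

theorem orb_Gw (h : Mem H Gw) : Orb H ![x1, x2, w, y2, y1]
    ![x1, x2, w + k * x2, y2 - 2 * k * w - k ^ 2 * x2, y1] := by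
  have := Orb.iter (H := H) (fun k => ![x1, x2, w + k * x2, y2 - 2 * k * w - k ^ 2 * x2, y1])
    (fun k => orb_of_mem h _ _ (by rw [act_Gw]; apply vec_congr <;> ring)) k
  simpa using this

theorem orb_Hw (h : Mem H Hw) : Orb H ![x1, x2, w, y2, y1]
    ![x1, x2 - 2 * k * w - k ^ 2 * y2, w + k * y2, y2, y1] := by
  have := Orb.iter (H := H) (fun k => ![x1, x2 - 2 * k * w - k ^ 2 * y2, w + k * y2, y2, y1])
    (fun k => orb_of_mem h _ _ (by rw [act_Hw]; apply vec_congr <;> ring)) k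
  simpa using this

end iterates

/-- Rounding: reduce `a` modulo `x` to absolute value at most `|x|/2`. -/
theorem exists_round (a x : ℤ) (hx : x ≠ 0) : ∃ k : ℤ, 2 * |a + k * x| ≤ |x| := by
  have hpos : 0 < |x| := abs_pos.2 hx
  have key : ∀ X : ℤ, 0 < X → ∃ k : ℤ, 2 * |a + k * X| ≤ X := by
    intro X hX
    refine ⟨-((2 * a + X) / (2 * X)), ?_⟩
    have h1 := Int.emod_add_mul_ediv (2 * a + X) (2 * X)
    have h2 := Int.emod_nonneg (2 * a + X) (b := 2 * X) (by positivity)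
    have h3 := Int.emod_lt_of_pos (2 * a + X) (b := 2 * X) (by positivity)
    set q := (2 * a + X) / (2 * X)
    set r := (2 * a + X) % (2 * X)
    have : 2 * (a + -q * X) = r - X := by linarith
    have e : (2 : ℤ) * |a + -q * X| = |2 * (a + -q * X)| := by rw [abs_mul]; norm_num
    rw [e, this, abs_le]
    constructor <;> linarith
  obtain ⟨k, hk⟩ := key _ hpos
  rcases abs_choice x with h | h
  · exact ⟨k, by rwa [h] at hk ⊢⟩
  · refine ⟨-k, ?_⟩
    have e : a + -k * x = a + k * (|x|) := by rw [h]; ring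
    rw [e]
    exact hk

/-- Euclidean descent for isotropic vectors in rank five. -/
theorem descent5 (n : ℕ) : ∀ x1 x2 w y2 y1 : ℤ, x1.natAbs ≤ n → x1 ≠ 0 →
    x1 * y1 + x2 * y2 + w ^ 2 = 0 → ∃ c : ℤ, Orb K ![x1, x2, w, y2, y1] ![c, 0, 0, 0, 0] := by
  induction n with
  | zero => intro x1 x2 w y2 y1 h h0; omega
  | succ n ih =>
    intro x1 x2 w y2 y1 hn h0 hq
    obtain ⟨k, hk⟩ := exists_round x2 x1 h0
    have o1 := orb_Ex x1 x2 w y2 y1 k memK_Ex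
    have hq1 : x1 * (y1 - k * y2) + (x2 + k * x1) * y2 + w ^ 2 = 0 := by linarith
    generalize x2 + k * x1 = a at *
    generalize y1 - k * y2 = b at *
    obtain ⟨l, hl⟩ := exists_round y2 x1 h0
    have o2 := o1.trans (orb_Ey x1 a w y2 b l memK_Ey)
    have hq2 : x1 * (b - l * a) + a * (y2 + l * x1) + w ^ 2 = 0 := by linarith
    generalize y2 + l * x1 = c at *
    generalize b - l * a = d at *
    obtain ⟨m, hm⟩ := exists_round w x1 h0
    have o3 := o2.trans (orb_Ew x1 a w c d m memK_Ew)
    have hq3 : x1 * (d - 2 * m * w - m ^ 2 * x1) + a * c + (w + m * x1) ^ 2 = 0 := by linarith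
    generalize d - 2 * m * w - m ^ 2 * x1 = y at *
    generalize w + m * x1 = z at *
    clear o1 o2 hq hq1 hq2
    have hpos : 0 < |x1| := abs_pos.2 h0
    have hy : |y| < |x1| := by
      have h1 : |x1| * |y| ≤ |a| * |c| + |z| * |z| := by
        rw [← abs_mul, ← abs_mul, ← abs_mul, show x1 * y = -(a * c + z * z) by linarith, abs_neg]
        exact abs_add_le _ _
      have h2 : 4 * (|a| * |c|) ≤ |x1| * |x1| := by
        nlinarith [abs_nonneg a, abs_nonneg c]
      have h3 : 4 * (|z| * |z|) ≤ |x1| * |x1| := by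
        nlinarith [abs_nonneg z]
      by_contra hcon
      push Not at hcon
      nlinarith
    have e1 := Int.abs_eq_natAbs x1
    have e2 := Int.abs_eq_natAbs a
    have e3 := Int.abs_eq_natAbs c
    have e4 := Int.abs_eq_natAbs y
    by_cases hy0 : y = 0
    · subst hy0
      by_cases ha : a = 0
      · subst ha
        have hz : z = 0 := by
          have : z ^ 2 = 0 := by linarith
          exact pow_eq_zero_iff (two_ne_zero) |>.1 this
        subst hz
        by_cases hc : c = 0
        · subst hc
          exact ⟨x1, o3⟩
        · have o4 := (o3.trans (orb_of_mem memK_t2 _ _ (act_t2 _ _ _ _ _))).trans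
            (orb_of_mem memK_s12 _ _ (act_s12 _ _ _ _ _))
          obtain ⟨r, hr⟩ := ih c x1 0 0 0 (by omega) hc (by ring)
          exact ⟨r, o4.trans hr⟩
      · have o4 := o3.trans (orb_of_mem memK_s12 _ _ (act_s12 _ _ _ _ _))
        obtain ⟨r, hr⟩ := ih a x1 z 0 c (by omega) ha (by linarith)
        exact ⟨r, o4.trans hr⟩
    · have o4 := o3.trans (orb_of_mem memK_t1 _ _ (act_t1 _ _ _ _ _))
      obtain ⟨r, hr⟩ := ih y a z c x1 (by omega) hy0 (by linarith)
      exact ⟨r, o4.trans hr⟩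

theorem reduce5 (x1 x2 w y2 y1 : ℤ) (hq : x1 * y1 + x2 * y2 + w ^ 2 = 0) :
    ∃ c : ℤ, Orb K ![x1, x2, w, y2, y1] ![c, 0, 0, 0, 0] := by
  by_cases h1 : x1 = 0
  · by_cases h2 : y1 = 0
    · by_cases h3 : x2 = 0
      · by_cases h4 : y2 = 0
        · subst h1 h2 h3 h4
          have hw : w = 0 := by
            have : w ^ 2 = 0 := by linarith
            exact pow_eq_zero_iff (two_ne_zero) |>.1 this
          subst hw
          exact ⟨0, Orb.refl _ _⟩
        · have o := (orb_of_mem memK_t2 _ _ (act_t2 x1 x2 w y2 y1)).trans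
            (orb_of_mem memK_s12 _ _ (act_s12 _ _ _ _ _))
          obtain ⟨r, hr⟩ := descent5 _ y2 x1 w y1 x2 le_rfl h4 (by linarith)
          exact ⟨r, o.trans hr⟩
      · have o := orb_of_mem memK_s12 _ _ (act_s12 x1 x2 w y2 y1)
        obtain ⟨r, hr⟩ := descent5 _ x2 x1 w y1 y2 le_rfl h3 (by linarith)
        exact ⟨r, o.trans hr⟩
    · have o := orb_of_mem memK_t1 _ _ (act_t1 x1 x2 w y2 y1)
      obtain ⟨r, hr⟩ := descent5 _ y1 x2 w y2 x1 le_rfl h2 (by linarith)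
      exact ⟨r, o.trans hr⟩
  · exact descent5 _ x1 x2 w y2 y1 le_rfl h1 hq

/-- Euclidean descent in the rank three part. -/
theorem descent3 {H : Subgroup (GL (Fin 5) ℤ)} (ht : Mem H t2) (hg : Mem H Gw) (n : ℕ) :
    ∀ x w y : ℤ, x.natAbs ≤ n → x ≠ 0 → x * y + w ^ 2 = 0 →
      ∃ c : ℤ, Orb H ![0, x, w, y, 0] ![0, c, 0, 0, 0] := by
  induction n with
  | zero => intro x w y h h0; omega
  | succ n ih =>
    intro x w y hn h0 hq
    obtain ⟨m, hm⟩ := exists_round w x h0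
    have o3 := orb_Gw 0 x w y 0 m hg
    have hq3 : x * (y - 2 * m * w - m ^ 2 * x) + (w + m * x) ^ 2 = 0 := by linarith
    generalize y - 2 * m * w - m ^ 2 * x = d at *
    generalize w + m * x = z at *
    have hpos : 0 < |x| := abs_pos.2 h0
    have hy : |d| < |x| := by
      have h1 : |x| * |d| = |z| * |z| := by
        rw [← abs_mul, ← abs_mul, show x * d = -(z * z) by linarith, abs_neg]
      have h3 : 4 * (|z| * |z|) ≤ |x| * |x| := by
        nlinarith [abs_nonneg z]
      by_contra hcon
      push Not at hcon
      nlinarith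
    have e1 := Int.abs_eq_natAbs x
    have e2 := Int.abs_eq_natAbs d
    by_cases hd : d = 0
    · subst hd
      have hz : z = 0 := by
        have : z ^ 2 = 0 := by linarith
        exact pow_eq_zero_iff (two_ne_zero) |>.1 this
      subst hz
      exact ⟨x, o3⟩
    · have o4 := o3.trans (orb_of_mem ht _ _ (act_t2 _ _ _ _ _))
      obtain ⟨r, hr⟩ := ih d z x (by omega) hd (by linarith)
      exact ⟨r, o4.trans hr⟩

theorem reduce3 {H : Subgroup (GL (Fin 5) ℤ)} (ht : Mem H t2) (hg : Mem H Gw) (x w y : ℤ)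
    (hq : x * y + w ^ 2 = 0) : ∃ c : ℤ, Orb H ![0, x, w, y, 0] ![0, c, 0, 0, 0] := by
  by_cases h : x = 0
  · by_cases h2 : y = 0
    · subst h h2
      have hz : w = 0 := by
        have : w ^ 2 = 0 := by linarith
        exact pow_eq_zero_iff (two_ne_zero) |>.1 this
      subst hz
      exact ⟨0, Orb.refl _ _⟩
    · have o := orb_of_mem ht _ _ (act_t2 0 x w y 0)
      obtain ⟨r, hr⟩ := descent3 ht hg _ y w x le_rfl h2 (by linarith)
      exact ⟨r, o.trans hr⟩
  · exact descent3 ht hg _ x w y le_rfl h hq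

/-- The bilinear form. -/
def bl (u v : Fin 5 → ℤ) : ℤ :=
  u 0 * v 4 + u 4 * v 0 + u 1 * v 3 + u 3 * v 1 + 2 * u 2 * v 2

/-- Preserving the form. -/
def Iso (g : GL (Fin 5) ℤ) : Prop := ∀ u v, bl ((g : Mat) *ᵥ u) ((g : Mat) *ᵥ v) = bl u v

theorem Iso.mul {g h : GL (Fin 5) ℤ} (hg : Iso g) (hh : Iso h) : Iso (g * h) := by
  intro u v
  rw [Units.val_mul, ← Matrix.mulVec_mulVec, ← Matrix.mulVec_mulVec, hg, hh]

theorem Iso.inv {g : GL (Fin 5) ℤ} (hg : Iso g) : Iso g⁻¹ := by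
  intro u v
  rw [← hg, Matrix.mulVec_mulVec, Matrix.mulVec_mulVec, ← Units.val_mul, mul_inv_cancel,
    Units.val_one, Matrix.one_mulVec, Matrix.one_mulVec]

theorem vec_eta (v : Fin 5 → ℤ) : v = ![v 0, v 1, v 2, v 3, v 4] := by
  ext i; fin_cases i <;> rfl

theorem vec_ex (v : Fin 5 → ℤ) : ∃ a b c d e : ℤ, v = ![a, b, c, d, e] :=
  ⟨_, _, _, _, _, vec_eta v⟩

theorem iso_of_gen {X : M5} (h : ∀ a b c d e a' b' c' d' e' : ℤ,
    bl (toMat X *ᵥ ![a, b, c, d, e]) (toMat X *ᵥ ![a', b', c', d', e']) =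
      bl ![a, b, c, d, e] ![a', b', c', d', e'])
    (g : GL (Fin 5) ℤ) (hg : (g : Mat) = toMat X) : Iso g := by
  intro u v
  obtain ⟨a, b, c, d, e, rfl⟩ := vec_ex u
  obtain ⟨a', b', c', d', e', rfl⟩ := vec_ex v
  rw [hg]
  exact h _ _ _ _ _ _ _ _ _ _

theorem iso_K {g : GL (Fin 5) ℤ} (hg : g ∈ K) : Iso g := by
  induction hg using Subgroup.closure_induction with
  | mem x hx =>
    obtain ⟨p, hp, e⟩ := hx
    refine iso_of_gen ?_ x e
    simp only [G9, List.mem_cons, List.not_mem_nil, or_false] at hp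
    intros
    rcases hp with rfl | rfl | rfl | rfl | rfl | rfl <;>
      simp only [act_s12, act_t1, act_n1, act_nw, act_Ex, act_Ew] <;> simp [bl] <;> ring
  | one => intro u v; simp
  | mul x y _ _ hx hy => exact hx.mul hy
  | inv x _ hx => exact hx.inv

/-- A vector which is the image of a vector with a partner is primitive. -/
theorem unit_of_iso {g : GL (Fin 5) ℤ} (hg : Iso g) {u v t : Fin 5 → ℤ} {c : ℤ}
    (h : (g : Mat) *ᵥ u = c • t) (huv : bl u v = 1) : c = 1 ∨ c = -1 := by
  have h1 := hg u v
  rw [h, huv] at h1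
  have : c * bl t ((g : Mat) *ᵥ v) = 1 := by
    rw [← h1]; simp [bl]; ring
  exact Int.isUnit_iff.1 (IsUnit.of_mul_eq_one _ this)

theorem mulVec_basis (g : Mat) (a b c d e : ℤ) : g *ᵥ ![a, b, c, d, e] =
    a • (g *ᵥ e1) + b • (g *ᵥ e2) + c • (g *ᵥ ew) + d • (g *ᵥ f2) + e • (g *ᵥ f1) := by
  rw [← Matrix.mulVec_smul, ← Matrix.mulVec_smul, ← Matrix.mulVec_smul, ← Matrix.mulVec_smul,
    ← Matrix.mulVec_smul, ← Matrix.mulVec_add, ← Matrix.mulVec_add, ← Matrix.mulVec_add,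
    ← Matrix.mulVec_add]
  congr 1
  ext i
  fin_cases i <;> simp [e1, e2, ew, f2, f1]

theorem ext_basis {g h : GL (Fin 5) ℤ} (h1 : (g : Mat) *ᵥ e1 = (h : Mat) *ᵥ e1)
    (h2 : (g : Mat) *ᵥ e2 = (h : Mat) *ᵥ e2) (h3 : (g : Mat) *ᵥ ew = (h : Mat) *ᵥ ew)
    (h4 : (g : Mat) *ᵥ f2 = (h : Mat) *ᵥ f2) (h5 : (g : Mat) *ᵥ f1 = (h : Mat) *ᵥ f1) :
    g = h := by
  apply Units.ext
  apply Matrix.ext_of_mulVec_single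
  intro i
  rw [vec_eta (Pi.single i 1), mulVec_basis, mulVec_basis, h1, h2, h3, h4, h5]

theorem pull {H : Subgroup (GL (Fin 5) ℤ)} {h g : GL (Fin 5) ℤ} (hh : h ∈ H) (hg : h * g ∈ H) :
    g ∈ H := by
  have := H.mul_mem (H.inv_mem hh) hg
  rwa [inv_mul_cancel_left] at this

theorem stage5 (g : GL (Fin 5) ℤ) (hg : Iso g) (h1 : (g : Mat) *ᵥ e1 = e1)
    (h2 : (g : Mat) *ᵥ f1 = f1) (h3 : (g : Mat) *ᵥ e2 = e2) (h4 : (g : Mat) *ᵥ f2 = f2) :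
    g ∈ K := by
  obtain ⟨a, b, c, d, e, hv⟩ := vec_ex ((g : Mat) *ᵥ ew)
  have b1 := hg ew e1
  have b2 := hg ew f1
  have b3 := hg ew e2
  have b4 := hg ew f2
  have b5 := hg ew ew
  rw [h1, hv] at b1
  rw [h2, hv] at b2
  rw [h3, hv] at b3
  rw [h4, hv] at b4
  rw [hv] at b5
  simp [bl, e1, e2, ew, f1, f2] at b1 b2 b3 b4 b5
  subst b1 b2 b3 b4
  have hc : c = 1 ∨ c = -1 := by
    apply Int.isUnit_iff.1
    exact IsUnit.of_mul_eq_one c (by linarith)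
  rcases hc with rfl | rfl
  · have : g = 1 := by
      apply ext_basis
      · rw [h1]; simp
      · rw [h3]; simp
      · rw [hv]; simp [ew]
      · rw [h4]; simp
      · rw [h2]; simp
    rw [this]; exact K.one_mem
  · obtain ⟨k, hk, ek⟩ := memK_nw
    have : g = k := by
      apply ext_basis
      · rw [h1, ek, e1, act_nw]; simp
      · rw [h3, ek, e2, act_nw]; simp
      · rw [hv, ek, ew, act_nw]
      · rw [h4, ek, f2, act_nw]; simp
      · rw [h2, ek, f1, act_nw]; simp
    rw [this]; exact hk

theorem stage4 (g : GL (Fin 5) ℤ) (hg : Iso g) (h1 : (g : Mat) *ᵥ e1 = e1)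
    (h2 : (g : Mat) *ᵥ f1 = f1) (h3 : (g : Mat) *ᵥ e2 = e2) : g ∈ K := by
  obtain ⟨a, b, c, d, e, hv⟩ := vec_ex ((g : Mat) *ᵥ f2)
  have b1 := hg f2 e1
  have b2 := hg f2 f1
  have b3 := hg f2 e2
  have b5 := hg f2 f2
  rw [h1, hv] at b1
  rw [h2, hv] at b2
  rw [h3, hv] at b3
  rw [hv] at b5
  simp [bl, e1, e2, f1, f2] at b1 b2 b3 b5
  subst b1 b2 b3
  have hH : Mem (K ⊓ fixV e1 ⊓ fixV f1 ⊓ fixV e2) Hw :=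
    mem_fix (mem_fix (mem_fix memK_Hw _ (by rw [e1, act_Hw]; simp)) _
      (by rw [f1, act_Hw]; simp)) _ (by rw [e2, act_Hw]; simp)
  obtain ⟨h, ⟨⟨⟨hK, t1⟩, t2⟩, t3⟩, t4⟩ := orb_Hw 0 b c 1 0 (-c) hH
  have t1 : (h : Mat) *ᵥ e1 = e1 := t1
  have t2 : (h : Mat) *ᵥ f1 = f1 := t2
  have t3 : (h : Mat) *ᵥ e2 = e2 := t3
  apply pull hK
  refine stage5 _ ((iso_K hK).mul hg) ?_ ?_ ?_ ?_ <;>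
    rw [Units.val_mul, ← Matrix.mulVec_mulVec]
  · rw [h1, t1]
  · rw [h2, t2]
  · rw [h3, t3]
  · rw [hv, t4, f2]
    apply vec_congr <;> linarith

theorem stage3 (g : GL (Fin 5) ℤ) (hg : Iso g) (h1 : (g : Mat) *ᵥ e1 = e1)
    (h2 : (g : Mat) *ᵥ f1 = f1) : g ∈ K := by
  obtain ⟨a, b, c, d, e, hv⟩ := vec_ex ((g : Mat) *ᵥ e2)
  have b1 := hg e2 e1
  have b2 := hg e2 f1
  have b5 := hg e2 e2
  rw [h1, hv] at b1
  rw [h2, hv] at b2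
  rw [hv] at b5
  simp [bl, e1, e2, f1] at b1 b2 b5
  subst b1 b2
  have m1 : Mem (K ⊓ fixV e1 ⊓ fixV f1) t2 :=
    mem_fix (mem_fix memK_t2 _ (by rw [e1, act_t2])) _ (by rw [f1, act_t2])
  have m2 : Mem (K ⊓ fixV e1 ⊓ fixV f1) Gw :=
    mem_fix (mem_fix memK_Gw _ (by rw [e1, act_Gw]; simp)) _ (by rw [f1, act_Gw]; simp)
  have m3 : Mem (K ⊓ fixV e1 ⊓ fixV f1) n2 :=
    mem_fix (mem_fix memK_n2 _ (by rw [e1, act_n2]; simp)) _ (by rw [f1, act_n2]; simp)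
  obtain ⟨r, hr⟩ := reduce3 m1 m2 b c d (by linarith)
  have hr1 : r = 1 ∨ r = -1 := by
    obtain ⟨h, ⟨⟨hK, t1⟩, t2⟩, t4⟩ := hr
    refine unit_of_iso ((iso_K hK).mul hg) (u := e2) (v := f2) (t := e2) ?_ (by simp [bl, e2, f2])
    rw [Units.val_mul, ← Matrix.mulVec_mulVec, hv, t4]
    simp [e2]
  have hr2 : Orb (K ⊓ fixV e1 ⊓ fixV f1) ![0, b, c, d, 0] e2 := by
    rcases hr1 with rfl | rfl
    · exact hr
    · exact hr.trans (orb_of_mem m3 _ _ (by rw [act_n2, e2]; simp))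
  obtain ⟨h, ⟨⟨hK, t1⟩, t2⟩, t4⟩ := hr2
  have t1 : (h : Mat) *ᵥ e1 = e1 := t1
  have t2 : (h : Mat) *ᵥ f1 = f1 := t2
  apply pull hK
  refine stage4 _ ((iso_K hK).mul hg) ?_ ?_ ?_ <;>
    rw [Units.val_mul, ← Matrix.mulVec_mulVec]
  · rw [h1, t1]
  · rw [h2, t2]
  · rw [hv, t4]

theorem stage2 (g : GL (Fin 5) ℤ) (hg : Iso g) (h1 : (g : Mat) *ᵥ e1 = e1) : g ∈ K := by
  obtain ⟨a, b, c, d, e, hv⟩ := vec_ex ((g : Mat) *ᵥ f1)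
  have b1 := hg f1 e1
  have b5 := hg f1 f1
  rw [h1, hv] at b1
  rw [hv] at b5
  simp [bl, e1, f1] at b1 b5
  subst b1
  have m1 : Mem (K ⊓ fixV e1) Fx := mem_fix memK_Fx _ (by rw [e1, act_Fx]; simp)
  have m2 : Mem (K ⊓ fixV e1) Fy := mem_fix memK_Fy _ (by rw [e1, act_Fy]; simp)
  have m3 : Mem (K ⊓ fixV e1) Fw := mem_fix memK_Fw _ (by rw [e1, act_Fw]; simp)
  have o := ((orb_Fx a b c d 1 (-b) m1).trans (orb_Fy _ _ _ _ _ (-d) m2)).trans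
    (orb_Fw _ _ _ _ _ (-c) m3)
  obtain ⟨h, ⟨hK, t1⟩, t4⟩ := o
  have t1 : (h : Mat) *ᵥ e1 = e1 := t1
  apply pull hK
  refine stage3 _ ((iso_K hK).mul hg) ?_ ?_ <;>
    rw [Units.val_mul, ← Matrix.mulVec_mulVec]
  · rw [h1, t1]
  · rw [hv, t4, f1]
    apply vec_congr <;> linarith

theorem iso_mem_K (g : GL (Fin 5) ℤ) (hg : Iso g) : g ∈ K := by
  obtain ⟨a, b, c, d, e, hv⟩ := vec_ex ((g : Mat) *ᵥ e1)
  have b5 := hg e1 e1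
  rw [hv] at b5
  simp [bl, e1] at b5
  obtain ⟨r, hr⟩ := reduce5 a b c d e (by linarith)
  have hr1 : r = 1 ∨ r = -1 := by
    obtain ⟨h, hK, t4⟩ := hr
    refine unit_of_iso ((iso_K hK).mul hg) (u := e1) (v := f1) (t := e1) ?_ (by simp [bl, e1, f1])
    rw [Units.val_mul, ← Matrix.mulVec_mulVec, hv, t4]
    simp [e1]
  have hr2 : Orb K ![a, b, c, d, e] e1 := by
    rcases hr1 with rfl | rfl
    · exact hr
    · exact hr.trans (orb_of_mem memK_n1 _ _ (by rw [act_n1, e1]; simp))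
  obtain ⟨h, hK, t4⟩ := hr2
  apply pull hK
  refine stage2 _ ((iso_K hK).mul hg) ?_
  rw [Units.val_mul, ← Matrix.mulVec_mulVec, hv, t4]


/-! ### Transfer to `O_Q(ℤ)` -/

def P4 : Mat :=
  !![0, 0, -2, 1, -1; 1, 0, 0, 0, -1; 1, 0, -4, 0, -3; 1, 2, 0, 0, -1; 1, 2, -2, -1, 2]

def Pi2 : Mat :=
  !![2, 10, -2, -2, 2; 0, -4, 0, 4, 0; -1, 1, -1, 1, -1; 8, 4, -4, 0, 0; 2, 2, -2, -2, 2]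

def Kmat : Mat :=
  !![0, 0, 0, 0, 1; 0, 0, 0, 1, 0; 0, 0, 2, 0, 0; 0, 1, 0, 0, 0; 1, 0, 0, 0, 0]

theorem Pi2_P4 : Pi2 * P4 = (8 : ℤ) • (1 : Mat) := by decide +kernel

theorem P4_Pi2 : P4 * Pi2 = (8 : ℤ) • (1 : Mat) := by decide +kernel

theorem P4_form : P4ᵀ * matQ * P4 = (32 : ℤ) • Kmat := by decide +kernel

theorem P4_A : P4 * toMat mA.1 = matA * P4 := by decide +kernel

theorem P4_B : P4 * toMat mB.1 = matB * P4 := by decide +kernel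

theorem bl_eq (u v : Fin 5 → ℤ) : bl u v = u ⬝ᵥ (Kmat *ᵥ v) := by
  simp [bl, Kmat, dotProduct, Matrix.mulVec, Fin.sum_univ_succ]
  ring

theorem iso_of_mat {g : GL (Fin 5) ℤ} (h : (g : Mat)ᵀ * Kmat * (g : Mat) = Kmat) : Iso g := by
  intro u v
  have e : bl u v = u ⬝ᵥ (((g : Mat)ᵀ * Kmat * (g : Mat)) *ᵥ v) := by rw [h, bl_eq]
  rw [e, bl_eq, mul_assoc, ← Matrix.mulVec_mulVec, Matrix.dotProduct_mulVec u,
    Matrix.vecMul_transpose, Matrix.mulVec_mulVec]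

/-- Elements of `O_Q(ℤ)` congruent to one modulo eight preserve the lattice spanned by `P4`. -/
theorem conj_mem (g : GL (Fin 5) ℤ) (hg : g ∈ orthogonalSubgroup matQ) (X : Mat)
    (hX : (g : Mat) = 1 + (8 : ℤ) • X) : ∃ k ∈ K, P4 * (k : Mat) = (g : Mat) * P4 := by
  have e : P4 * (1 + Pi2 * X * P4) = (g : Mat) * P4 := by
    rw [hX, mul_add, add_mul, mul_one, one_mul, ← mul_assoc, ← mul_assoc, P4_Pi2]
    simp
  have hdet0 : P4.det ≠ 0 := by
    intro h0
    have := congrArg Matrix.det Pi2_P4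
    rw [Matrix.det_mul, h0, Matrix.det_smul] at this
    simp at this
  have hdet : IsUnit (1 + Pi2 * X * P4).det := by
    have h1 := congrArg Matrix.det e
    rw [Matrix.det_mul, Matrix.det_mul, mul_comm] at h1
    rw [mul_right_cancel₀ hdet0 h1]
    exact (Matrix.isUnit_iff_isUnit_det _).1 g.isUnit
  obtain ⟨k, hk⟩ := (Matrix.isUnit_iff_isUnit_det _).2 hdet
  rw [← hk] at e
  refine ⟨k, iso_mem_K k (iso_of_mat ?_), e⟩
  have hQ : (g : Mat)ᵀ * matQ * (g : Mat) = matQ := hg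
  have h32 : (32 : ℤ) • ((k : Mat)ᵀ * Kmat * (k : Mat)) = (32 : ℤ) • Kmat := by
    calc (32 : ℤ) • ((k : Mat)ᵀ * Kmat * (k : Mat))
        = (k : Mat)ᵀ * ((32 : ℤ) • Kmat) * (k : Mat) := by
          rw [mul_smul_comm, smul_mul_assoc]
      _ = (P4 * (k : Mat))ᵀ * matQ * (P4 * (k : Mat)) := by
          rw [← P4_form]; simp only [Matrix.transpose_mul, mul_assoc]
      _ = P4ᵀ * ((g : Mat)ᵀ * matQ * (g : Mat)) * P4 := by
          rw [e]; simp only [Matrix.transpose_mul, mul_assoc]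
      _ = (32 : ℤ) • Kmat := by rw [hQ, P4_form]
  exact smul_right_injective _ (by norm_num : (32 : ℤ) ≠ 0) h32

abbrev MatQ := Matrix (Fin 5) (Fin 5) ℚ

def toQ (x : Mat) : MatQ := x.map (Int.castRingHom ℚ)

theorem toQ_mul (x y : Mat) : toQ (x * y) = toQ x * toQ y := Matrix.map_mul

theorem toQ_inj : Function.Injective toQ := Matrix.map_injective Int.cast_injective

theorem toQ_eight : toQ ((8 : ℤ) • (1 : Mat)) = (8 : ℚ) • (1 : MatQ) := by
  ext i j
  simp only [toQ, Matrix.map_apply, Matrix.smul_apply, Matrix.one_apply]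
  by_cases h : i = j <;> simp [h]

/-- The change of basis over the rationals. -/
def pQ : GL (Fin 5) ℚ where
  val := toQ P4
  inv := (8⁻¹ : ℚ) • toQ Pi2
  val_inv := by rw [mul_smul_comm, ← toQ_mul, P4_Pi2, toQ_eight, smul_smul]; norm_num
  inv_val := by rw [smul_mul_assoc, ← toQ_mul, Pi2_P4, toQ_eight, smul_smul]; norm_num

def io : GL (Fin 5) ℤ →* GL (Fin 5) ℚ := Matrix.GeneralLinearGroup.map (Int.castRingHom ℚ)

theorem io_val (g : GL (Fin 5) ℤ) : ((io g : GL (Fin 5) ℚ) : MatQ) = toQ (g : Mat) := rfl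

theorem io_inj : Function.Injective io := by
  intro x y h
  apply Units.ext
  apply toQ_inj
  rw [← io_val, ← io_val, h]

def ph : GL (Fin 5) ℤ →* GL (Fin 5) ℚ := (MulAut.conj pQ).toMonoidHom.comp io

theorem ph_inj : Function.Injective ph := (MulAut.conj pQ).injective.comp io_inj

theorem ph_eq {k g : GL (Fin 5) ℤ} (h : P4 * (k : Mat) = (g : Mat) * P4) : ph k = io g := by
  change pQ * io k * pQ⁻¹ = io g
  rw [mul_inv_eq_iff_eq_mul]
  apply Units.ext
  change toQ P4 * toQ (k : Mat) = toQ (g : Mat) * toQ P4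
  rw [← toQ_mul, ← toQ_mul, h]

/-- The principal congruence subgroup of level eight. -/
def ker8 : Subgroup (GL (Fin 5) ℤ) :=
  (Matrix.GeneralLinearGroup.map (n := Fin 5) (Int.castRingHom (ZMod 8))).ker

theorem ker8_index : ker8.index ≠ 0 := by
  have : Finite (Matrix (Fin 5) (Fin 5) (ZMod 8)) := inferInstance
  have : Finite (GL (Fin 5) (ZMod 8)) := Finite.of_injective _ Units.val_injective
  rw [ker8, Subgroup.index_ker]
  exact Nat.card_pos.ne'

theorem ker8_spec {g : GL (Fin 5) ℤ} (hg : g ∈ ker8) : ∃ X : Mat, (g : Mat) = 1 + (8 : ℤ) • X := by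
  have h1 : Matrix.GeneralLinearGroup.map (n := Fin 5) (Int.castRingHom (ZMod 8)) g = 1 := hg
  have h : ∀ i j, (8 : ℤ) ∣ ((g : Mat) - 1) i j := by
    intro i j
    have h2 := congrArg (fun u : GL (Fin 5) (ZMod 8) => (u : Matrix (Fin 5) (Fin 5) (ZMod 8)) i j) h1
    have h3 : (((g : Mat) i j : ℤ) : ZMod 8) = (1 : Matrix (Fin 5) (Fin 5) (ZMod 8)) i j := h2
    have h4 : ((((g : Mat) - 1) i j : ℤ) : ZMod 8) = 0 := by
      rw [Matrix.sub_apply, Int.cast_sub, h3]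
      by_cases hij : i = j <;> simp [Matrix.one_apply, hij]
    exact_mod_cast (ZMod.intCast_zmod_eq_zero_iff_dvd _ 8).1 h4
  choose X hX using h
  refine ⟨Matrix.of X, ?_⟩
  ext i j
  have := hX i j
  rw [Matrix.sub_apply] at this
  simp only [Matrix.add_apply, Matrix.smul_apply, Matrix.of_apply, smul_eq_mul]
  linarith

theorem finite_relIndex (A B : GL (Fin 5) ℤ) (hA : (A : Mat) = matA) (hB : (B : Mat) = matB) :
    (Subgroup.closure {A, B}).relIndex (orthogonalSubgroup matQ) ≠ 0 := by
  set Γ := Subgroup.closure {A, B} with hΓ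
  set G8' := orthogonalSubgroup matQ ⊓ ker8 with hG8
  have h1 : G8'.relIndex (orthogonalSubgroup matQ) ≠ 0 := by
    rw [hG8, Subgroup.inf_relIndex_left]
    intro h0
    apply ker8_index
    exact Subgroup.index_eq_zero_of_relIndex_eq_zero h0
  have hsub1 : (grp G0).map ph ≤ Γ.map io := by
    rw [grp, MonoidHom.map_closure, Subgroup.closure_le]
    rintro _ ⟨g, ⟨p, hp, e⟩, rfl⟩
    simp only [G0, List.mem_cons, List.not_mem_nil, or_false] at hp
    rcases hp with rfl | rfl
    · refine ⟨A, Subgroup.subset_closure (by simp), (ph_eq ?_).symm⟩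
      rw [e, hA, P4_A]
    · refine ⟨B, Subgroup.subset_closure (by simp), (ph_eq ?_).symm⟩
      rw [e, hB, P4_B]
  have hsub2 : G8'.map io ≤ (grp G9).map ph := by
    rintro _ ⟨g, ⟨hg, hg8⟩, rfl⟩
    obtain ⟨X, hX⟩ := ker8_spec hg8
    obtain ⟨k, hk, e⟩ := conj_mem g hg X hX
    exact ⟨k, hk, ph_eq e⟩
  have h2 : Γ.relIndex G8' ≠ 0 := by
    rw [← Subgroup.relIndex_map_map_of_injective _ _ io_inj]
    intro h0
    have h3 := Subgroup.relIndex_eq_zero_of_le_left hsub1 h0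
    have h4 := Subgroup.relIndex_eq_zero_of_le_right hsub2 h3
    rw [Subgroup.relIndex_map_map_of_injective _ _ ph_inj] at h4
    exact chain_finite h4
  exact Subgroup.relIndex_ne_zero_trans h2 h1

end HG

/-- Case 1 of Theorem 1.2: the hypergeometric group `Γ(f,g)` generated by the companion matrices `A`, `B`
of `f(x) = x^5 - 2*x^4 + x^3 - x^2 + 2*x - 1` and `g(x) = x^5 + x^4 + 2*x^3 + 2*x^2 + x + 1`
is an arithmetic subgroup of `O_Q(ℤ)`: it preserves `Q`, it is contained in `O_Q(ℤ)`,
and it has finite index in `O_Q(ℤ)`. -/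
theorem hypergeometric_group_arithmetic
    (A B : GL (Fin 5) ℤ)
    (hA : (A : Matrix (Fin 5) (Fin 5) ℤ) = matA)
    (hB : (B : Matrix (Fin 5) (Fin 5) ℤ) = matB) :
    matAᵀ * matQ * matA = matQ ∧
    matBᵀ * matQ * matB = matQ ∧
    Subgroup.closure {A, B} ≤ orthogonalSubgroup matQ ∧
    ((Subgroup.closure {A, B}).subgroupOf (orthogonalSubgroup matQ)).FiniteIndex := by
  have h1 : matAᵀ * matQ * matA = matQ := by decide +kernel
  have h2 : matBᵀ * matQ * matB = matQ := by decide +kernel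
  refine ⟨h1, h2, ?_, ⟨HG.finite_relIndex A B hA hB⟩⟩
  rw [Subgroup.closure_le]
  rintro g (rfl | rfl)
  · change (g : Matrix (Fin 5) (Fin 5) ℤ)ᵀ * matQ * (g : Matrix (Fin 5) (Fin 5) ℤ) = matQ
    rw [hA, h1]
  · change (g : Matrix (Fin 5) (Fin 5) ℤ)ᵀ * matQ * (g : Matrix (Fin 5) (Fin 5) ℤ) = matQ
    rw [hB, h2]
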